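/- Let $f$ be $(n+1)$ times continuously differentiable on $[0,1]$ and let $p_n$ be the polynomial of degree at most $n$ interpolating $f$ at distinct nodes $x_0, \ldots, x_n \in [0,1]$. Let $\alpha \in \mathbb{R}^+\setminus\mathbb{Z}$ with $m = \lceil\alpha\rceil \le n+1$. Then for each $x \in (0,1]$ there exists $\xi = \xi(x) \in (0,1)$ such that $D^\alpha f(x) - D^\alpha p_n(x) = \frac{f^{(n+1)}(\xi)}{(n+1)!\,\Gamma(m-\alpha)} \int_0^x \frac{\omega^{(m)}(\tau)}{(x-\tau)^{\alpha+1-m}}\, d\tau$ is NOT claimed pointwise without further hypotheses; rather, the following bound holds: $|D^\alpha f(x) - D^\alpha p_n(x)| \le \frac{\|f^{(n+1)}\|_{L^\infty([0,1])}}{(n+1)!\,\Gamma(m-\alpha+1)}\, x^{m-\alpha}\, \|\omega^{(m)}\|_{L^\infty([0,1])}$, where $\omega(t) = \prod_{k=0}^n (t - x_k)$. -/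

import Mathlib

open Real

/-- The Caputo fractional derivative of order `α` (with `m = ⌈α⌉`) of `f` at `x`. -/
noncomputable def caputoDeriv (α : ℝ) (f : ℝ → ℝ) (x : ℝ) : ℝ :=
  (1 / Real.Gamma ((⌈α⌉₊ : ℝ) - α)) *
    ∫ τ in (0:ℝ)..x, (x - τ) ^ ((⌈α⌉₊ : ℝ) - α - 1) * iteratedDeriv ⌈α⌉₊ f τ

section

open Polynomial Lagrange Set

theorem exists_finset_deriv_eq_zero {u : ℝ → ℝ} (hu : Continuous u) {a b : ℝ} {k : ℕ}
    {s : Finset ℝ} (hs : s.card = k + 1) (hsub : ↑s ⊆ Icc a b) (h0 : ∀ z ∈ s, u z = 0) :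
    ∃ s' : Finset ℝ, s'.card = k ∧ ↑s' ⊆ Icc a b ∧ Disjoint s s' ∧ ∀ z ∈ s', deriv u z = 0 := by
  set e := s.orderEmbOfFin hs with he
  have hmem : ∀ i, e i ∈ s := fun i => s.orderEmbOfFin_mem hs i
  have key : ∀ i : Fin k, ∃ c ∈ Ioo (e i.castSucc) (e i.succ), deriv u c = 0 := fun i =>
    exists_deriv_eq_zero (e.strictMono (Fin.castSucc_lt_succ)) hu.continuousOn
      (by rw [h0 _ (hmem _), h0 _ (hmem _)])
  choose c hc hc0 using key
  have hmono : StrictMono c := by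
    intro i j hij
    have h1 : e i.succ ≤ e j.castSucc := e.monotone (by
      rw [Fin.le_def]; simpa using hij)
    linarith [(hc i).2, (hc j).1]
  refine ⟨Finset.univ.image c, ?_, ?_, ?_, ?_⟩
  · rw [Finset.card_image_of_injective _ hmono.injective]; simp
  · intro z hz
    simp only [Finset.coe_image, Finset.coe_univ, Set.image_univ, Set.mem_range] at hz
    obtain ⟨i, rfl⟩ := hz
    have h1 := hsub (hmem i.castSucc)
    have h2 := hsub (hmem i.succ)
    exact ⟨h1.1.trans (hc i).1.le, (hc i).2.le.trans h2.2⟩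
  · rw [Finset.disjoint_right]
    intro z hz hzs
    simp only [Finset.mem_image, Finset.mem_univ, true_and] at hz
    obtain ⟨i, rfl⟩ := hz
    have : c i ∈ Set.range e := by rw [he, Finset.range_orderEmbOfFin]; exact hzs
    obtain ⟨j, hj⟩ := this
    have h1 := (hc i).1
    have h2 := (hc i).2
    rw [← hj] at h1 h2
    have h1 := e.lt_iff_lt.1 h1
    have h2 := e.lt_iff_lt.1 h2
    rw [Fin.lt_def] at h1 h2
    simp at h1 h2
    omega
  · intro z hz
    simp only [Finset.mem_image, Finset.mem_univ, true_and] at hz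
    obtain ⟨i, rfl⟩ := hz
    exact hc0 i

theorem exists_iteratedDeriv_eq_zero {k : ℕ} : ∀ {u : ℝ → ℝ} (_ : ContDiff ℝ k u) {a b : ℝ}
    {s : Finset ℝ} (_ : s.card = k + 1) (_ : ↑s ⊆ Icc a b) (_ : ∀ z ∈ s, u z = 0),
    ∃ ξ ∈ Icc a b, iteratedDeriv k u ξ = 0 := by
  induction k with
  | zero =>
    intro u _ a b s hs hsub h0
    obtain ⟨z, hz⟩ := Finset.card_pos.1 (by omega : 0 < s.card)
    exact ⟨z, hsub hz, by simpa using h0 z hz⟩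
  | succ k ih =>
    intro u hu a b s hs hsub h0
    obtain ⟨s', hs', hsub', -, h0'⟩ := exists_finset_deriv_eq_zero hu.continuous hs hsub h0
    rw [iteratedDeriv_succ']
    exact ih (ContDiff.iterate_deriv' k 1 (by exact_mod_cast hu)) hs' hsub' h0'

theorem iteratedDeriv_polynomial_eval (P : ℝ[X]) (k : ℕ) :
    iteratedDeriv k (fun x => P.eval x) = fun x => (derivative^[k] P).eval x := by
  induction k generalizing P with
  | zero => simp
  | succ k ih =>
    rw [iteratedDeriv_succ', Function.iterate_succ_apply, ← ih]
    congr 1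
    ext x
    exact P.deriv

theorem contDiff_polynomial_eval (P : ℝ[X]) {k : WithTop ℕ∞} :
    ContDiff ℝ k (fun x => P.eval x) := by
  simpa using P.contDiff_aeval (𝕜 := ℝ) (n := k)

theorem eval_nodal_id_of_mem {Y : Finset ℝ} {z : ℝ} (hz : z ∈ Y) : (nodal Y id).eval z = 0 :=
  eval_nodal_at_node (v := id) hz

theorem iterate_derivative_nodal_card (Y : Finset ℝ) :
    derivative^[Y.card] (nodal Y id) = C (Y.card.factorial : ℝ) := by
  rw [nodal_eq]
  simp only [id]
  rw [iterate_derivative_prod_X_sub_C le_rfl]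
  simp

theorem iteratedDeriv_sub_polynomial {u : ℝ → ℝ} {k : ℕ} (hu : ContDiff ℝ k u) (P : ℝ[X])
    (x : ℝ) : iteratedDeriv k (fun x => u x - P.eval x) x =
      iteratedDeriv k u x - (derivative^[k] P).eval x := by
  rw [iteratedDeriv_fun_sub hu.contDiffAt (contDiff_polynomial_eval P).contDiffAt,
    iteratedDeriv_polynomial_eval]

theorem exists_iteratedDeriv_eq_factorial_mul {u : ℝ → ℝ} {N : ℕ} (hu : ContDiff ℝ N u)
    {Y : Finset ℝ} (hY : Y.card = N) {v ξ : ℝ}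
    (h : iteratedDeriv N (fun x => u x - (C v * nodal Y id).eval x) ξ = 0) :
    iteratedDeriv N u ξ = v * N.factorial := by
  rw [iteratedDeriv_sub_polynomial hu, iterate_derivative_C_mul, ← hY,
    iterate_derivative_nodal_card, hY] at h
  simp at h
  linarith

theorem abs_le_factorial_inv_mul_abs_eval_nodal {u : ℝ → ℝ} {N : ℕ} (hu : ContDiff ℝ N u)
    {Y : Finset ℝ} (hY : Y.card = N) {a b A : ℝ} (hsub : ↑Y ⊆ Icc a b)
    (h0 : ∀ z ∈ Y, u z = 0)
    (hA : ∀ x ∈ Icc a b, |iteratedDeriv N u x| ≤ A) {c : ℝ} (hc : c ∈ Icc a b) :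
    |u c| ≤ A / N.factorial * |(nodal Y id).eval c| := by
  have hN : (0:ℝ) < N.factorial := by positivity
  by_cases hcY : c ∈ Y
  · rw [h0 c hcY, eval_nodal_id_of_mem hcY]
    simp
  have hne : (nodal Y id).eval c ≠ 0 := eval_nodal_not_at_node (v := id)
    (fun i hi h => hcY (by rw [h]; exact hi))
  set v := u c / (nodal Y id).eval c with hv
  obtain ⟨ξ, hξ, h⟩ := exists_iteratedDeriv_eq_zero
    (u := fun x => u x - (C v * nodal Y id).eval x) (k := N) (s := insert c Y) (a := a) (b := b)
    (hu.sub (contDiff_polynomial_eval _))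
    (by rw [Finset.card_insert_of_notMem hcY, hY])
    (by rw [Finset.coe_insert]; exact Set.insert_subset hc hsub)
    (by
      intro z hz
      rcases Finset.mem_insert.1 hz with rfl | hz
      · simp [hv, hne]
      · simp [h0 z hz, eval_nodal_id_of_mem hz])
  have h2 := exists_iteratedDeriv_eq_factorial_mul hu hY h
  have h3 := hA ξ hξ
  rw [h2, abs_mul, abs_of_pos hN, ← le_div_iff₀ hN] at h3
  have : u c = v * (nodal Y id).eval c := by rw [hv, div_mul_cancel₀ _ hne]
  rw [this, abs_mul]
  gcongr

theorem abs_deriv_le_factorial_inv_mul {u : ℝ → ℝ} {N : ℕ} (hu : ContDiff ℝ N u)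
    {Y : Finset ℝ} (hY : Y.card = N) {a b A : ℝ} (hsub : ↑Y ⊆ Icc a b)
    (h0 : ∀ z ∈ Y, u z = 0)
    (hA : ∀ x ∈ Icc a b, |iteratedDeriv N u x| ≤ A) {z : ℝ} (hz : z ∈ Y) :
    |deriv u z| ≤ A / N.factorial * |(nodal (Y.erase z) id).eval z| := by
  have hN : (0:ℝ) < N.factorial := by positivity
  obtain ⟨n, rfl⟩ : ∃ n, N = n + 1 := ⟨N - 1, by
    have := Finset.card_pos.2 ⟨z, hz⟩; omega⟩
  have hne : (nodal (Y.erase z) id).eval z ≠ 0 := eval_nodal_not_at_node (v := id)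
    (fun i hi h => (Finset.ne_of_mem_erase hi) h.symm)
  have hΩ : (derivative (nodal Y id)).eval z = (nodal (Y.erase z) id).eval z :=
    eval_nodal_derivative_eval_node_eq (v := id) hz
  have hu1 : Differentiable ℝ u := hu.differentiable (by simp)
  set v := deriv u z / (nodal (Y.erase z) id).eval z with hv
  set w : ℝ → ℝ := fun x => u x - (C v * nodal Y id).eval x with hw
  have hwc : ContDiff ℝ (n + 1 : ℕ) w := hu.sub (contDiff_polynomial_eval _)
  obtain ⟨s', hs', hsub', hdis, h0'⟩ := exists_finset_deriv_eq_zero (u := w) hwc.continuous hY hsub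
    (by
      intro y hy
      simp [hw, h0 y hy, eval_nodal_id_of_mem hy])
  have hzs : z ∉ s' := Finset.disjoint_left.1 hdis hz
  obtain ⟨ξ, hξ, h⟩ := exists_iteratedDeriv_eq_zero
    (u := deriv w) (k := n) (s := insert z s') (a := a) (b := b)
    (ContDiff.iterate_deriv' n 1 (by exact_mod_cast hwc))
    (by rw [Finset.card_insert_of_notMem hzs, hs'])
    (by rw [Finset.coe_insert]; exact Set.insert_subset (hsub hz) hsub')
    (by
      intro y hy
      rcases Finset.mem_insert.1 hy with rfl | hy
      · have h1 : HasDerivAt w (deriv u y - (derivative (C v * nodal Y id)).eval y) y :=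
          hu1.differentiableAt.hasDerivAt.sub ((C v * nodal Y id).hasDerivAt y)
        rw [h1.deriv, derivative_C_mul, eval_mul, eval_C, hΩ, hv, div_mul_cancel₀ _ hne, sub_self]
      · exact h0' y hy)
  rw [← iteratedDeriv_succ'] at h
  have h2 := exists_iteratedDeriv_eq_factorial_mul hu hY h
  have h3 := hA ξ hξ
  rw [h2, abs_mul, abs_of_pos hN, ← le_div_iff₀ hN] at h3
  have : deriv u z = v * (nodal (Y.erase z) id).eval z := by rw [hv, div_mul_cancel₀ _ hne]
  rw [this, abs_mul]
  gcongr

section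

open Filter Topology Asymptotics

theorem iterate_derivative_X_sub_C_mul (P : ℝ[X]) (c : ℝ) (m : ℕ) :
    derivative^[m] ((X - C c) * P) =
      (X - C c) * derivative^[m] P + C (m : ℝ) * derivative^[m - 1] P := by
  induction m with
  | zero => simp
  | succ m ih =>
    rw [Function.iterate_succ_apply', ih]
    rcases m with _ | m
    · simp [derivative_mul]; ring
    · simp only [derivative_add, derivative_mul, derivative_X_sub_C, derivative_C,
        Nat.add_sub_cancel, ← Function.iterate_succ_apply' (f := derivative)]
      push_cast
      simp only [Nat.succ_eq_add_one, C_add, C_1]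
      ring

theorem eval_iterate_derivative_X_sub_C_mul_derivative (Q : ℝ[X]) (t : ℝ) (m : ℕ) :
    (derivative^[m] ((X - C t) * derivative Q)).eval t = m * (derivative^[m] Q).eval t := by
  rw [iterate_derivative_X_sub_C_mul]
  rcases m with _ | m
  · simp
  · simp

theorem eval_iterate_derivative_interpolate (Y : Finset ℝ) (r : ℝ → ℝ) (m : ℕ) (t : ℝ) :
    (derivative^[m] (interpolate Y id r)).eval t =
      ∑ z ∈ Y, r z * (derivative^[m] (Lagrange.basis Y id z)).eval t := by
  rw [interpolate_apply, iterate_derivative_sum, eval_finsetSum]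
  simp [iterate_derivative_C_mul]

theorem degree_X_sub_C_mul_derivative_lt {Q : ℝ[X]} {k : ℕ} (hQ : Q.degree < (k : WithBot ℕ))
    (t : ℝ) : ((X - C t) * derivative Q).degree < (k : WithBot ℕ) := by
  by_cases h0 : derivative Q = 0
  · simp only [h0, mul_zero, degree_zero]
    exact WithBot.bot_lt_coe k
  have hQ0 : Q ≠ 0 := by rintro rfl; simp at h0
  refine lt_of_le_of_lt ?_ hQ
  rw [degree_mul, degree_X_sub_C, degree_eq_natDegree h0, degree_eq_natDegree hQ0]
  have h1 : Q.natDegree ≠ 0 := fun h => h0 (derivative_of_natDegree_zero h)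
  have h2 := natDegree_derivative_lt h1
  exact_mod_cast (by omega : 1 + (derivative Q).natDegree ≤ Q.natDegree)

theorem interpolate_sub_mul_eq (Y : Finset ℝ) (t : ℝ) (r' : ℝ → ℝ) {Q : ℝ[X]}
    (hQ : Q.degree < Y.card) :
    interpolate Y id (fun z => (z - t) * r' z) = (X - C t) * derivative Q +
      ∑ z ∈ Y, C ((z - t) * ((r' z - (derivative Q).eval z) / (nodal (Y.erase z) id).eval z)) *
        nodal (Y.erase z) id := by
  symm
  apply eq_interpolate_of_eval_eq (v := id) _ Function.injective_id.injOn
  · refine (degree_add_le _ _).trans_lt (max_lt (degree_X_sub_C_mul_derivative_lt hQ t) ?_)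
    refine (degree_sum_le _ _).trans_lt ((Finset.sup_lt_iff (WithBot.bot_lt_coe _)).2 ?_)
    intro z hz
    rw [← smul_eq_C_mul]
    refine (degree_smul_le _ _).trans_lt ?_
    rw [degree_nodal]
    exact_mod_cast Finset.card_erase_lt_of_mem hz
  · intro z hz
    have hne : (nodal (Y.erase z) id).eval z ≠ 0 := eval_nodal_not_at_node (v := id)
      (fun i hi h => (Finset.ne_of_mem_erase hi) h.symm)
    simp only [id, eval_add, eval_mul, eval_sub, eval_X, eval_C, eval_finsetSum]
    rw [Finset.sum_eq_single_of_mem z hz]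
    · field_simp; ring
    · intro y hy hyz
      have : (nodal (Y.erase y) id).eval z = 0 :=
        eval_nodal_id_of_mem (Finset.mem_erase.2 ⟨hyz.symm, hz⟩)
      change _ * eval z (nodal (Y.erase y) id) = 0
      rw [this, mul_zero]

theorem sum_dilate_deriv_sub_eq {u : ℝ → ℝ} {Y : Finset ℝ} (t s : ℝ) (m : ℕ) :
    (∑ z ∈ Y, ((z - t) * (s * deriv u (t + s * (z - t)))) *
        (derivative^[m] (Lagrange.basis Y id z)).eval t) -
      m * ∑ z ∈ Y, u (t + s * (z - t)) * (derivative^[m] (Lagrange.basis Y id z)).eval t =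
    ∑ z ∈ Y, (z - t) * ((s * deriv u (t + s * (z - t)) -
      (derivative (interpolate Y id (fun y => u (t + s * (y - t))))).eval z) /
        (nodal (Y.erase z) id).eval z) * (derivative^[m] (nodal (Y.erase z) id)).eval t := by
  have hQ : (interpolate Y id (fun y => u (t + s * (y - t)))).degree < Y.card :=
    degree_interpolate_lt _ Function.injective_id.injOn
  have h := congrArg (fun P => (derivative^[m] P).eval t)
    (interpolate_sub_mul_eq Y t (fun z => s * deriv u (t + s * (z - t))) hQ)
  rw [eval_iterate_derivative_interpolate, iterate_map_add, eval_add,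
    eval_iterate_derivative_X_sub_C_mul_derivative, eval_iterate_derivative_interpolate,
    iterate_derivative_sum, eval_finsetSum] at h
  rw [h, add_sub_cancel_left]
  refine Finset.sum_congr rfl fun z _ => ?_
  rw [iterate_derivative_C_mul, eval_mul, eval_C]

theorem add_mul_sub_mem_Icc {a b t x s : ℝ} (ht : t ∈ Icc a b) (hx : x ∈ Icc a b)
    (hs : s ∈ Icc (0:ℝ) 1) : t + s * (x - t) ∈ Icc a b := by
  have := convex_Icc a b ht hx (sub_nonneg.2 hs.2) hs.1 (by ring)
  simp only [smul_eq_mul] at this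
  convert this using 1
  ring

theorem iteratedDeriv_dilate {u : ℝ → ℝ} {N : ℕ} (hu : ContDiff ℝ N u) (t s x : ℝ) :
    iteratedDeriv N (fun x => u (t + s * (x - t))) x =
      s ^ N * iteratedDeriv N u (t + s * (x - t)) := by
  have h1 : ContDiff ℝ N (fun y => u ((t - s * t) + y)) :=
    hu.comp (contDiff_const.add contDiff_id)
  have h2 := iteratedDeriv_comp_const_mul h1 s
  have h3 : (fun x => u (t + s * (x - t))) = fun x => u ((t - s * t) + s * x) := by
    ext x; ring_nf
  rw [h3, h2]
  simp only [iteratedDeriv_comp_const_add]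
  ring_nf

theorem abs_dilate_deriv_sub_le {u : ℝ → ℝ} {N : ℕ} (hu : ContDiff ℝ N u)
    {Y : Finset ℝ} (hY : Y.card = N) {a b A : ℝ} (hsub : ↑Y ⊆ Icc a b)
    (hA : ∀ x ∈ Icc a b, |iteratedDeriv N u x| ≤ A) {t s : ℝ} (ht : t ∈ Icc a b)
    (hs : s ∈ Icc (0:ℝ) 1) {z : ℝ} (hz : z ∈ Y) :
    |(s * deriv u (t + s * (z - t)) -
      (derivative (interpolate Y id (fun y => u (t + s * (y - t))))).eval z) /
        (nodal (Y.erase z) id).eval z| ≤ s ^ N * A / N.factorial := by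
  have hne : (nodal (Y.erase z) id).eval z ≠ 0 := eval_nodal_not_at_node (v := id)
    (fun i hi h => (Finset.ne_of_mem_erase hi) h.symm)
  have hN0 : N ≠ 0 := by
    rintro rfl
    rw [Finset.card_eq_zero] at hY
    simp [hY] at hz
  set Q := interpolate Y id (fun y => u (t + s * (y - t))) with hQdef
  have hQ : Q.degree < Y.card := degree_interpolate_lt _ Function.injective_id.injOn
  have hd : ContDiff ℝ N (fun x => u (t + s * (x - t))) :=
    hu.comp (contDiff_const.add (contDiff_const.mul (contDiff_id.sub contDiff_const)))
  have h := abs_deriv_le_factorial_inv_mul (u := fun x => u (t + s * (x - t)) - Q.eval x)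
    (A := s ^ N * A) (hd.sub (contDiff_polynomial_eval Q)) hY hsub
    (by
      intro y hy
      have := eval_interpolate_at_node (v := id) (fun y => u (t + s * (y - t)))
        Function.injective_id.injOn hy
      simp only [id] at this
      rw [hQdef, this, sub_self])
    (by
      intro x hx
      rw [iteratedDeriv_sub_polynomial hd, iteratedDeriv_dilate hu,
        iterate_derivative_eq_zero_of_degree_lt (by rwa [hY] at hQ), eval_zero, sub_zero, abs_mul,
        abs_of_nonneg (pow_nonneg hs.1 N)]
      exact mul_le_mul_of_nonneg_left (hA _ (add_mul_sub_mem_Icc ht hx hs)) (pow_nonneg hs.1 N))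
    hz
  have hderiv : deriv (fun x => u (t + s * (x - t)) - Q.eval x) z =
      s * deriv u (t + s * (z - t)) - (derivative Q).eval z := by
    have h1 : HasDerivAt (fun x => t + s * (x - t)) s z := by
      simpa using (((hasDerivAt_id z).sub_const t).const_mul s).const_add t
    have h2 : HasDerivAt u (deriv u (t + s * (z - t))) (t + s * (z - t)) :=
      (hu.differentiable (by exact_mod_cast hN0)).differentiableAt.hasDerivAt
    have h3 : HasDerivAt (fun x => u (t + s * (x - t)) - Q.eval x)
        (deriv u (t + s * (z - t)) * s - (derivative Q).eval z) z :=
      (h2.comp z h1).sub (Q.hasDerivAt z)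
    rw [h3.deriv, mul_comm]
  rw [hderiv] at h
  rw [abs_div, div_le_iff₀ (abs_pos.2 hne)]
  exact h

theorem abs_eval_iterate_derivative_interpolate_le {u : ℝ → ℝ} {N m : ℕ} (hmN : m < N)
    (hu : ContDiff ℝ N u) {Y : Finset ℝ} (hY : Y.card = N) {a b A : ℝ} (hsub : ↑Y ⊆ Icc a b)
    (hA : ∀ x ∈ Icc a b, |iteratedDeriv N u x| ≤ A) {t : ℝ} (ht : t ∈ Icc a b)
    (ho : u =o[𝓝 t] fun x => (x - t) ^ m) :
    |(derivative^[m] (interpolate Y id u)).eval t| ≤ A / N.factorial / (N - m : ℕ) *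
      ∑ z ∈ Y, |t - z| * |(derivative^[m] (nodal (Y.erase z) id)).eval t| := by
  obtain ⟨r, rfl⟩ : ∃ r, N = m + r + 1 := ⟨N - m - 1, by omega⟩
  set S := ∑ z ∈ Y, |t - z| * |(derivative^[m] (nodal (Y.erase z) id)).eval t| with hS
  set c : ℝ → ℝ := fun z => (derivative^[m] (Lagrange.basis Y id z)).eval t with hc
  set K := A / (m + r + 1).factorial * S with hK
  set G : ℝ → ℝ := fun s => (∑ z ∈ Y, u (t + s * (z - t)) * c z) / s ^ m with hG
  set D : ℝ → ℝ := fun s => (∑ z ∈ Y, ((z - t) * (s * deriv u (t + s * (z - t)))) * c z) -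
      m * ∑ z ∈ Y, u (t + s * (z - t)) * c z with hD
  have hDle : ∀ s ∈ Icc (0:ℝ) 1, |D s| ≤ s ^ (m + r + 1) * K := by
    intro s hs
    rw [hD]
    simp only [hc]
    rw [sum_dilate_deriv_sub_eq, hK, hS, ← mul_assoc, Finset.mul_sum]
    refine (Finset.abs_sum_le_sum_abs _ _).trans (Finset.sum_le_sum fun z hz => ?_)
    rw [abs_mul, abs_mul, abs_sub_comm z t]
    have := abs_dilate_deriv_sub_le hu hY hsub hA ht hs hz
    calc _ ≤ |t - z| * (s ^ (m + r + 1) * A / (m + r + 1).factorial) *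
          |(derivative^[m] (nodal (Y.erase z) id)).eval t| := by gcongr
      _ = _ := by ring
  have hGd : ∀ s, 0 < s → HasDerivAt G (D s / s ^ (m + 1)) s := by
    intro s hs
    have h1 : HasDerivAt (fun s => ∑ z ∈ Y, u (t + s * (z - t)) * c z)
        (∑ z ∈ Y, ((z - t) * deriv u (t + s * (z - t))) * c z) s := by
      refine HasDerivAt.fun_sum fun z _ => ?_
      have h1 : HasDerivAt (fun s => t + s * (z - t)) (z - t) s := by
        simpa using ((hasDerivAt_id s).mul_const (z - t)).const_add t
      have h2 : HasDerivAt u (deriv u (t + s * (z - t))) (t + s * (z - t)) :=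
        (hu.differentiable (by simp)).differentiableAt.hasDerivAt
      have h3 := (h2.comp s h1).mul_const (c z)
      rwa [mul_comm (deriv u _)] at h3
    have h2 := h1.div (hasDerivAt_pow m s) (pow_ne_zero m hs.ne')
    refine h2.congr_deriv ?_
    have h4 : (∑ z ∈ Y, ((z - t) * (s * deriv u (t + s * (z - t)))) * c z) =
        s * ∑ z ∈ Y, ((z - t) * deriv u (t + s * (z - t))) * c z := by
      rw [Finset.mul_sum]; exact Finset.sum_congr rfl fun z _ => by ring
    simp only [hD]
    rw [h4]
    generalize (∑ z ∈ Y, ((z - t) * deriv u (t + s * (z - t))) * c z) = E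
    generalize (∑ z ∈ Y, u (t + s * (z - t)) * c z) = F
    rcases m with _ | m
    · simp; field_simp
    · rw [Nat.add_sub_cancel]
      field_simp
      ring
  have hG0 : Tendsto G (𝓝[>] 0) (𝓝 0) := by
    have : ∀ z, Tendsto (fun s => u (t + s * (z - t)) / s ^ m) (𝓝[>] 0) (𝓝 0) := by
      intro z
      have h1 : Tendsto (fun s : ℝ => t + s * (z - t)) (𝓝[>] 0) (𝓝 t) := by
        have : Tendsto (fun s : ℝ => t + s * (z - t)) (𝓝 0) (𝓝 (t + 0 * (z - t))) :=
          Continuous.tendsto (by fun_prop) 0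
        rw [zero_mul, add_zero] at this
        exact this.mono_left nhdsWithin_le_nhds
      have h2 := ho.comp_tendsto h1
      have h3 : ((fun x => (x - t) ^ m) ∘ fun s : ℝ => t + s * (z - t)) =O[𝓝[>] 0]
          fun s => s ^ m := by
        refine IsBigO.of_bound (|z - t| ^ m) (Eventually.of_forall fun s => ?_)
        simp [mul_pow, mul_comm]
      exact (h2.trans_isBigO h3).tendsto_div_nhds_zero
    have h2 : Tendsto (fun s => ∑ z ∈ Y, u (t + s * (z - t)) / s ^ m * c z) (𝓝[>] 0)
        (𝓝 (∑ z ∈ Y, 0 * c z)) := tendsto_finsetSum _ fun z _ => (this z).mul_const _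
    simp only [zero_mul, Finset.sum_const_zero] at h2
    refine h2.congr fun s => ?_
    simp only [hG]
    rw [Finset.sum_div]
    exact Finset.sum_congr rfl fun z _ => by ring
  have key : ∀ ε : ℝ, |ε| = 1 → 0 ≤ K / (r + 1 : ℕ) + ε * G 1 := by
    intro ε hε
    set H : ℝ → ℝ := fun s => K / (r + 1 : ℕ) * s ^ (r + 1) + ε * G s with hH
    have hHd : ∀ s, 0 < s → HasDerivAt H (K * s ^ r + ε * (D s / s ^ (m + 1))) s := by
      intro s hs
      have h1 := ((hasDerivAt_pow (r + 1) s).const_mul (K / (r + 1 : ℕ))).add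
        ((hGd s hs).const_mul ε)
      refine h1.congr_deriv ?_
      rw [Nat.add_sub_cancel]
      have : ((r + 1 : ℕ) : ℝ) ≠ 0 := by positivity
      field_simp
    have hmono : MonotoneOn H (Ioc 0 1) := by
      refine monotoneOn_of_deriv_nonneg (convex_Ioc 0 1) ?_ ?_ ?_
      · exact fun s hs => (hHd s hs.1).continuousAt.continuousWithinAt
      · rw [interior_Ioc]
        exact fun s hs => (hHd s hs.1).differentiableAt.differentiableWithinAt
      · rw [interior_Ioc]
        intro s hs
        rw [(hHd s hs.1).deriv]
        have h1 := hDle s ⟨hs.1.le, hs.2.le⟩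
        have h2 : |ε * (D s / s ^ (m + 1))| ≤ K * s ^ r := by
          rw [abs_mul, hε, one_mul, abs_div, abs_of_pos (pow_pos hs.1 (m + 1)),
            div_le_iff₀ (pow_pos hs.1 _)]
          calc _ ≤ _ := h1
            _ = _ := by ring
        linarith [neg_abs_le (ε * (D s / s ^ (m + 1)))]
    have hlim : Tendsto H (𝓝[>] 0) (𝓝 0) := by
      have h1 : Tendsto (fun s : ℝ => K / (r + 1 : ℕ) * s ^ (r + 1)) (𝓝[>] 0) (𝓝 0) := by
        have : Tendsto (fun s : ℝ => K / (r + 1 : ℕ) * s ^ (r + 1)) (𝓝 0)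
          (𝓝 (K / (r + 1 : ℕ) * 0 ^ (r + 1))) := Continuous.tendsto (by fun_prop) 0
        simp only [ne_eq, Nat.add_eq_zero_iff, one_ne_zero, and_false, not_false_eq_true, zero_pow,
          mul_zero] at this
        exact this.mono_left nhdsWithin_le_nhds
      simpa [hH] using h1.add (hG0.const_mul ε)
    have : 0 ≤ H 1 := by
      refine le_of_tendsto hlim ?_
      filter_upwards [Ioc_mem_nhdsGT (zero_lt_one' ℝ)] with s hs
      exact hmono hs ⟨zero_lt_one, le_rfl⟩ hs.2
    simpa [hH] using this
  have hG1 : G 1 = (derivative^[m] (interpolate Y id u)).eval t := by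
    rw [eval_iterate_derivative_interpolate]
    simp [hG, hc]
  have e1 := key 1 (by simp)
  have e2 := key (-1) (by simp)
  rw [hG1] at e1 e2
  have e3 : A / (m + r + 1).factorial / (m + r + 1 - m : ℕ) * S = K / (r + 1 : ℕ) := by
    rw [hK, show m + r + 1 - m = r + 1 by omega]; ring
  rw [e3, abs_le]
  constructor <;> linarith

theorem exists_polynomial_taylor {u : ℝ → ℝ} {m : ℕ} (hu : ContDiff ℝ m u) (t : ℝ) :
    ∃ T : ℝ[X], T.natDegree ≤ m ∧ (derivative^[m] T).eval t = iteratedDeriv m u t ∧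
      (fun x => u x - T.eval x) =o[𝓝 t] fun x => (x - t) ^ m := by
  refine ⟨∑ i ∈ Finset.range (m + 1), C ((i.factorial : ℝ)⁻¹ * iteratedDeriv i u t) *
    (X - C t) ^ i, ?_, ?_, ?_⟩
  · refine natDegree_sum_le_of_forall_le _ _ fun i hi => ?_
    refine (natDegree_C_mul_le _ _).trans ?_
    rw [natDegree_pow, natDegree_X_sub_C]
    have := Finset.mem_range.1 hi
    omega
  · rw [iterate_derivative_sum, eval_finsetSum, Finset.sum_eq_single_of_mem m (by simp)]
    · rw [iterate_derivative_C_mul, iterate_derivative_X_sub_pow_self]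
      have : (m.factorial : ℝ) ≠ 0 := by positivity
      simp
      field_simp
    · intro i hi him
      have := Finset.mem_range.1 hi
      rw [iterate_derivative_C_mul, iterate_derivative_X_sub_pow,
        Nat.descFactorial_eq_zero_iff_lt.2 (by omega)]
      simp
  · have h := taylor_isLittleO_univ (x₀ := t) hu
    refine h.congr_left fun x => ?_
    rw [taylor_within_apply]
    simp only [eval_finsetSum, eval_mul, eval_C, eval_pow, eval_sub, eval_X,
      iteratedDerivWithin_univ, smul_eq_mul]
    congr 1
    exact Finset.sum_congr rfl fun i _ => by ring

theorem abs_iteratedDeriv_sub_interpolate_le {u : ℝ → ℝ} {N m : ℕ} (hmN : m < N)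
    (hu : ContDiff ℝ N u) {Y : Finset ℝ} (hY : Y.card = N) {a b A : ℝ} (hsub : ↑Y ⊆ Icc a b)
    (hA : ∀ x ∈ Icc a b, |iteratedDeriv N u x| ≤ A) {t : ℝ} (ht : t ∈ Icc a b) :
    |iteratedDeriv m u t - (derivative^[m] (interpolate Y id u)).eval t| ≤
      A / N.factorial / (N - m : ℕ) *
      ∑ z ∈ Y, |t - z| * |(derivative^[m] (nodal (Y.erase z) id)).eval t| := by
  obtain ⟨T, hT, hTm, ho⟩ := exists_polynomial_taylor
    (hu.of_le (by exact_mod_cast hmN.le) : ContDiff ℝ m u) t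
  have hTd : T.degree < Y.card := by
    rw [hY]
    exact degree_le_natDegree.trans_lt (by exact_mod_cast hT.trans_lt hmN)
  have h := abs_eval_iterate_derivative_interpolate_le hmN (u := fun x => u x - T.eval x) (A := A)
    (hu.sub (contDiff_polynomial_eval T)) hY hsub
    (by
      intro x hx
      rw [iteratedDeriv_sub_polynomial hu,
        iterate_derivative_eq_zero_of_degree_lt (by rwa [hY] at hTd), eval_zero, sub_zero]
      exact hA x hx) ht ho
  have h2 : interpolate Y id (fun x => u x - T.eval x) = interpolate Y id u - T := by
    have : interpolate Y id (fun x => T.eval x) = T :=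
      (eq_interpolate (v := id) Function.injective_id.injOn hTd).symm
    rw [← this, ← map_sub, this]
    rfl
  rw [h2, iterate_derivative_sub, eval_sub, hTm, abs_sub_comm] at h
  exact h

end

theorem splits_derivative {p : ℝ[X]} (hp : p.Splits) : (derivative p).Splits := by
  by_cases h0 : p.natDegree = 0
  · rw [derivative_of_natDegree_zero h0]
    exact Splits.zero
  · rw [splits_iff_card_roots] at hp ⊢
    have h1 := card_roots_le_derivative p
    have h2 := card_roots' (derivative p)
    have h3 := natDegree_derivative_lt h0
    omega

theorem splits_iterate_derivative {p : ℝ[X]} (hp : p.Splits) (k : ℕ) :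
    (derivative^[k] p).Splits := by
  induction k with
  | zero => exact hp
  | succ k ih => rw [Function.iterate_succ_apply']; exact splits_derivative ih

theorem eval_mul_eval_derivative_derivative_le {p : ℝ[X]} (hp : p.Splits) (t : ℝ) :
    p.eval t * (derivative (derivative p)).eval t ≤ (derivative p).eval t ^ 2 := by
  have key : ∀ s : Multiset ℝ, (s.map (X - C ·)).prod.eval t *
      (derivative (derivative (s.map (X - C ·)).prod)).eval t ≤
        (derivative (s.map (X - C ·)).prod).eval t ^ 2 := by
    intro s
    induction s using Multiset.induction_on with
    | empty => simp
    | cons z s ih =>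
      rw [Multiset.map_cons, Multiset.prod_cons]
      set P := (s.map (X - C ·)).prod
      simp only [derivative_mul, derivative_X_sub_C, one_mul, derivative_add, eval_add, eval_mul,
        eval_sub, eval_X, eval_C]
      nlinarith [sq_nonneg (P.eval t), mul_nonneg (sq_nonneg (t - z)) (sub_nonneg.2 ih)]
  rw [hp.eq_prod_roots]
  simp only [derivative_C_mul, eval_mul, eval_C]
  nlinarith [mul_nonneg (sq_nonneg p.leadingCoeff) (sub_nonneg.2 (key p.roots))]

theorem splits_nodal (Y : Finset ℝ) : (nodal Y id).Splits := by
  rw [nodal_eq]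
  exact Splits.prod fun i _ => Splits.X_sub_C _

theorem nodal_eq_X_sub_C_mul_nodal_erase {Y : Finset ℝ} {z : ℝ} (hz : z ∈ Y) :
    nodal Y id = (X - C z) * nodal (Y.erase z) id :=
  nodal_eq_mul_nodal_erase (v := id) hz

theorem eval_iterate_derivative_nodal_eq {Y : Finset ℝ} {z : ℝ} (hz : z ∈ Y) (m : ℕ) (t : ℝ) :
    (derivative^[m] (nodal Y id)).eval t =
      (t - z) * (derivative^[m] (nodal (Y.erase z) id)).eval t +
        m * (derivative^[m - 1] (nodal (Y.erase z) id)).eval t := by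
  rw [nodal_eq_X_sub_C_mul_nodal_erase hz, iterate_derivative_X_sub_C_mul]
  simp

theorem mul_iterate_derivative_nodal_erase_nonneg {Y : Finset ℝ} {m : ℕ} {t : ℝ}
    (h : (derivative^[m] (nodal Y id)).eval t = 0) {z z' : ℝ} (hz : z ∈ Y) (hz' : z' ∈ Y) :
    0 ≤ (derivative^[m] (nodal (Y.erase z) id)).eval t *
      (derivative^[m] (nodal (Y.erase z') id)).eval t := by
  by_cases hne : z = z'
  · subst hne; exact mul_self_nonneg _
  have h1 : z' ∈ Y.erase z := Finset.mem_erase.2 ⟨Ne.symm hne, hz'⟩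
  have h2 : z ∈ Y.erase z' := Finset.mem_erase.2 ⟨hne, hz⟩
  have e0 := eval_iterate_derivative_nodal_eq hz m t
  have e1 := eval_iterate_derivative_nodal_eq h1 m t
  have e2 := eval_iterate_derivative_nodal_eq h2 m t
  have e3 := eval_iterate_derivative_nodal_eq h1 (m - 1) t
  rw [Finset.erase_right_comm] at e2
  set ψ := nodal ((Y.erase z).erase z') id
  have hψ : ψ.Splits := splits_nodal _
  rw [h, e1, e3] at e0
  rw [e1, e2]
  rcases m with _ | _ | m
  · simp only [Function.iterate_zero, id, CharP.cast_eq_zero] at *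
    refine le_of_eq ?_
    linear_combination ψ.eval t * e0
  · simp only [Function.iterate_one, Function.iterate_zero, id, Nat.cast_zero, Nat.cast_one, zero_add,
      Nat.sub_self, one_mul, zero_mul, add_zero] at *
    refine le_of_le_of_eq (sq_nonneg (ψ.eval t)) ?_
    linear_combination (derivative ψ).eval t * e0
  · have hL := eval_mul_eval_derivative_derivative_le (splits_iterate_derivative hψ m) t
    simp only [← Function.iterate_succ_apply' (f := derivative)] at hL
    simp only [Nat.add_sub_cancel, Nat.succ_eq_add_one] at *
    push_cast at *
    set α := (derivative^[m + 1 + 1] ψ).eval t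
    set β := (derivative^[m + 1] ψ).eval t
    set γ := (derivative^[m] ψ).eval t
    have hm : (0:ℝ) ≤ m := Nat.cast_nonneg m
    have e4 : ((t - z') * α + (m + 1 + 1) * β) * ((t - z) * α + (m + 1 + 1) * β) =
        (m + 1 + 1) * ((m + 1) * (β ^ 2 - γ * α) + β ^ 2) := by
      linear_combination (-α) * e0
    rw [e4]
    have := sub_nonneg.2 hL
    positivity

theorem sum_mul_iterate_derivative_nodal_erase (Y : Finset ℝ) (m : ℕ) (t : ℝ) :
    ∑ z ∈ Y, (t - z) * (derivative^[m] (nodal (Y.erase z) id)).eval t =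
      (Y.card - m : ℝ) * (derivative^[m] (nodal Y id)).eval t := by
  have h1 : ∑ z ∈ Y, (m : ℝ) * (derivative^[m - 1] (nodal (Y.erase z) id)).eval t =
      m * (derivative^[m] (nodal Y id)).eval t := by
    rcases m with _ | m
    · simp
    · rw [← Finset.mul_sum, Nat.add_sub_cancel, Function.iterate_succ_apply, derivative_nodal,
        iterate_derivative_sum, eval_finsetSum]
  have h2 : ∀ z ∈ Y, (t - z) * (derivative^[m] (nodal (Y.erase z) id)).eval t =
      (derivative^[m] (nodal Y id)).eval t -
        m * (derivative^[m - 1] (nodal (Y.erase z) id)).eval t := fun z hz => by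
    rw [eval_iterate_derivative_nodal_eq hz]; ring
  rw [Finset.sum_congr rfl h2, Finset.sum_sub_distrib, h1]
  simp
  ring

theorem sum_abs_eq_abs_sum_of_sign {ι : Type*} {s : Finset ι} {a : ι → ℝ}
    (h : (∀ i ∈ s, 0 ≤ a i) ∨ ∀ i ∈ s, a i ≤ 0) : ∑ i ∈ s, |a i| = |∑ i ∈ s, a i| := by
  rcases h with h | h
  · rw [abs_of_nonneg (Finset.sum_nonneg h)]
    exact Finset.sum_congr rfl fun i hi => abs_of_nonneg (h i hi)
  · rw [abs_of_nonpos (Finset.sum_nonpos h), ← Finset.sum_neg_distrib]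
    exact Finset.sum_congr rfl fun i hi => abs_of_nonpos (h i hi)

theorem sign_of_pairwise_mul_nonneg {ι : Type*} {s : Finset ι} {a : ι → ℝ}
    (h : ∀ i ∈ s, ∀ j ∈ s, 0 ≤ a i * a j) : (∀ i ∈ s, 0 ≤ a i) ∨ ∀ i ∈ s, a i ≤ 0 := by
  by_contra! hcon
  obtain ⟨⟨i, hi, hi0⟩, ⟨j, hj, hj0⟩⟩ := hcon
  nlinarith [h i hi j hj]

theorem abs_iteratedDeriv_sub_interpolate_le_of_sign {u : ℝ → ℝ} {N m : ℕ} (hmN : m < N)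
    (hu : ContDiff ℝ N u) {Y : Finset ℝ} (hY : Y.card = N) {a b A : ℝ} (hsub : ↑Y ⊆ Icc a b)
    (hA : ∀ x ∈ Icc a b, |iteratedDeriv N u x| ≤ A) {t : ℝ} (ht : t ∈ Icc a b)
    (hs : (∀ z ∈ Y, 0 ≤ (t - z) * (derivative^[m] (nodal (Y.erase z) id)).eval t) ∨
      ∀ z ∈ Y, (t - z) * (derivative^[m] (nodal (Y.erase z) id)).eval t ≤ 0) :
    |iteratedDeriv m u t - (derivative^[m] (interpolate Y id u)).eval t| ≤
      A / N.factorial * |(derivative^[m] (nodal Y id)).eval t| := by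
  refine (abs_iteratedDeriv_sub_interpolate_le hmN hu hY hsub hA ht).trans (le_of_eq ?_)
  simp only [← abs_mul]
  rw [sum_abs_eq_abs_sum_of_sign hs, sum_mul_iterate_derivative_nodal_erase, hY, abs_mul,
    ← Nat.cast_sub hmN.le, Nat.abs_cast]
  have : ((N - m : ℕ) : ℝ) ≠ 0 := by
    have : N - m ≠ 0 := by omega
    exact_mod_cast this
  field_simp

theorem nodal_id_insert {Y : Finset ℝ} {z : ℝ} (hz : z ∉ Y) :
    nodal (insert z Y) id = (X - C z) * nodal Y id :=
  nodal_insert_eq_nodal (v := id) hz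

theorem sign_mul_iterate_derivative_nodal_erase {Z : Finset ℝ} {m : ℕ} {t : ℝ} (ht : t ∉ Z)
    (h : (derivative^[m] (nodal Z id)).eval t = 0) :
    (∀ z ∈ insert t Z,
      0 ≤ (t - z) * (derivative^[m] (nodal ((insert t Z).erase z) id)).eval t) ∨
    ∀ z ∈ insert t Z,
      (t - z) * (derivative^[m] (nodal ((insert t Z).erase z) id)).eval t ≤ 0 := by
  have key : ∀ z ∈ Z, (t - z) * (derivative^[m] (nodal ((insert t Z).erase z) id)).eval t =
      -((t - z) ^ 2 * (derivative^[m] (nodal (Z.erase z) id)).eval t) := by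
    intro z hz
    have htz : t ≠ z := fun e => ht (e ▸ hz)
    have h1 : t ∉ Z.erase z := fun e => ht (Finset.mem_of_mem_erase e)
    rw [Finset.erase_insert_of_ne htz, nodal_id_insert h1, iterate_derivative_X_sub_C_mul]
    rw [eval_iterate_derivative_nodal_eq hz] at h
    simp only [eval_add, eval_mul, eval_sub, eval_X, eval_C, sub_self, zero_mul, zero_add]
    linear_combination (t - z) * h
  refine sign_of_pairwise_mul_nonneg fun i hi j hj => ?_
  rcases Finset.mem_insert.1 hi with rfl | hi
  · simp
  rcases Finset.mem_insert.1 hj with rfl | hj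
  · simp
  rw [key i hi, key j hj]
  have := mul_iterate_derivative_nodal_erase_nonneg h hi hj
  have h2 : 0 ≤ (t - i) ^ 2 * (t - j) ^ 2 * ((derivative^[m] (nodal (Z.erase i) id)).eval t *
    (derivative^[m] (nodal (Z.erase j) id)).eval t) := by positivity
  nlinarith [h2]

theorem eval_iterate_derivative_interpolate_insert {R : Finset ℝ} {c t : ℝ} {m : ℕ} {u : ℝ → ℝ}
    (hc : c ∉ R) (ht : t ∉ insert c R) (h0 : ∀ z ∈ R, u z = 0)
    (hq : (derivative^[m] (nodal (insert c R) id)).eval t = 0) :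
    (derivative^[m] (interpolate (insert t (insert c R)) id u)).eval t =
      u c / (nodal R id).eval c * (derivative^[m] (nodal R id)).eval t := by
  have hψc : (nodal R id).eval c ≠ 0 := eval_nodal_not_at_node (v := id)
    (fun i hi h => hc (by rw [h]; exact hi))
  have hqt : (nodal (insert c R) id).eval t ≠ 0 := eval_nodal_not_at_node (v := id)
    (fun i hi h => ht (by rw [h]; exact hi))
  set k := u c / (nodal R id).eval c with hk
  set l := (u t - k * (nodal R id).eval t) / (nodal (insert c R) id).eval t with hl
  have : interpolate (insert t (insert c R)) id u =
      C k * nodal R id + C l * nodal (insert c R) id := by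
    symm
    apply eq_interpolate_of_eval_eq (v := id) _ Function.injective_id.injOn
    · rw [Finset.card_insert_of_notMem ht, Finset.card_insert_of_notMem hc, ← smul_eq_C_mul,
        ← smul_eq_C_mul]
      refine (degree_add_le _ _).trans_lt (max_lt ((degree_smul_le _ _).trans_lt ?_)
        ((degree_smul_le _ _).trans_lt ?_))
      · rw [degree_nodal]; exact_mod_cast (by omega)
      · rw [degree_nodal, Finset.card_insert_of_notMem hc]; exact_mod_cast (by omega)
    · intro z hz
      simp only [id, eval_add, eval_mul, eval_C]
      rcases Finset.mem_insert.1 hz with rfl | hz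
      · rw [hl]; field_simp; ring
      have hz0 : (nodal (insert c R) id).eval z = 0 := eval_nodal_id_of_mem hz
      rcases Finset.mem_insert.1 hz with rfl | hz
      · rw [hz0, hk]; field_simp; ring
      · rw [hz0, eval_nodal_id_of_mem hz, h0 z hz]; ring
  rw [this, iterate_map_add, iterate_derivative_C_mul, iterate_derivative_C_mul]
  simp [hq]

theorem abs_iteratedDeriv_le_of_sign_change {u : ℝ → ℝ} {N m : ℕ} (hm : m ≠ 0) (hmN : m < N)
    (hu : ContDiff ℝ N u) {Y : Finset ℝ} (hY : Y.card = N) {l r A : ℝ} (hsub : ↑Y ⊆ Icc l r)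
    (h0 : ∀ z ∈ Y, u z = 0)
    (hA : ∀ x ∈ Icc l r, |iteratedDeriv N u x| ≤ A) {t : ℝ} (ht : t ∈ Icc l r) (htY : t ∉ Y)
    {a b : ℝ} (ha : a ∈ Y) (hb : b ∈ Y)
    (hneg : (derivative^[m] (nodal (Y.erase a) id)).eval t < 0)
    (hpos : 0 < (derivative^[m] (nodal (Y.erase b) id)).eval t)
    (hβ : (derivative^[m - 1] (nodal ((Y.erase a).erase b) id)).eval t ≠ 0)
    (hz : ∀ z, z ∈ Y →
      (derivative^[m] ((X - C z) * nodal ((Y.erase a).erase b) id)).eval t ≠ 0) :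
    |iteratedDeriv m u t| ≤ A / N.factorial * |(derivative^[m] (nodal Y id)).eval t| := by
  have hab : a ≠ b := by rintro rfl; linarith
  have hba : b ∈ Y.erase a := Finset.mem_erase.2 ⟨hab.symm, hb⟩
  have hab' : a ∈ Y.erase b := Finset.mem_erase.2 ⟨hab, ha⟩
  have ea := eval_iterate_derivative_nodal_eq hba m t
  have eb := eval_iterate_derivative_nodal_eq hab' m t
  have e0 := eval_iterate_derivative_nodal_eq ha m t
  have e1 := eval_iterate_derivative_nodal_eq hba (m - 1) t
  rw [Finset.erase_right_comm] at eb
  set R := (Y.erase a).erase b with hR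
  have hRc : R.card + 2 = N := by
    have h1 := Finset.card_erase_add_one ha
    have h2 := Finset.card_erase_add_one hba
    rw [← hR] at h2
    omega
  have hRY : R ⊆ Y := (Finset.erase_subset _ _).trans (Finset.erase_subset _ _)
  set ψ := nodal R id with hψ
  set α := (derivative^[m] ψ).eval t with hα
  set β' := (derivative^[m - 1] ψ).eval t with hβ'
  set γ' := (derivative^[m - 1 - 1] ψ).eval t with hγ'
  have hm' : (m : ℝ) ≠ 0 := by exact_mod_cast hm
  rw [ea] at hneg
  rw [eb] at hpos
  have hα0 : α ≠ 0 := by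
    intro h
    rw [h] at hneg hpos
    linarith
  set c := t + m * β' / α with hc
  have hcα : (t - c) * α + m * β' = 0 := by rw [hc]; field_simp; ring
  have hcab : (c - a) * (c - b) < 0 := by
    have h1 : (c - b) * α < 0 := by linarith
    have h2 : 0 < (c - a) * α := by linarith
    have h3 := mul_neg_of_pos_of_neg h2 h1
    have h4 : 0 < α ^ 2 := by positivity
    by_contra hcon
    have := mul_nonneg (not_lt.1 hcon) h4.le
    linarith
  have hcI : c ∈ Icc l r := by
    have h1 := hsub ha
    have h2 := hsub hb
    constructor
    · by_contra h
      push Not at h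
      nlinarith [mul_nonneg (by linarith [h1.1] : 0 ≤ a - c) (by linarith [h2.1] : 0 ≤ b - c)]
    · by_contra h
      push Not at h
      nlinarith [mul_nonneg (by linarith [h1.2] : 0 ≤ c - a) (by linarith [h2.2] : 0 ≤ c - b)]
  have htc : t ≠ c := by
    intro h
    rw [← h, sub_self, zero_mul, zero_add] at hcα
    exact (mul_ne_zero hm' hβ) hcα
  have hq : ∀ z, (derivative^[m] ((X - C z) * ψ)).eval t = (t - z) * α + m * β' := by
    intro z
    rw [iterate_derivative_X_sub_C_mul]
    simp [hα, hβ']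
  have hcR : c ∉ R := fun h => hz c (hRY h) (by rw [hq, hcα])
  have htR : t ∉ insert c R := by
    rw [Finset.mem_insert, not_or]
    exact ⟨htc, fun h => htY (hRY h)⟩
  have hqt : (derivative^[m] (nodal (insert c R) id)).eval t = 0 := by
    rw [nodal_id_insert hcR, hq, hcα]
  have hsign := sign_mul_iterate_derivative_nodal_erase htR hqt
  have hVc : (insert t (insert c R)).card = N := by
    rw [Finset.card_insert_of_notMem htR, Finset.card_insert_of_notMem hcR, ← hRc]
  have hVs : (↑(insert t (insert c R)) : Set ℝ) ⊆ Icc l r := by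
    rw [Finset.coe_insert, Finset.coe_insert]
    exact insert_subset ht (insert_subset hcI ((Finset.coe_subset.2 hRY).trans hsub))
  have hb1 := abs_iteratedDeriv_sub_interpolate_le_of_sign hmN hu hVc hVs hA ht hsign
  rw [eval_iterate_derivative_interpolate_insert hcR htR (fun z hz => h0 z (hRY hz)) hqt,
    ← hψ, ← hα] at hb1
  have hb2 := abs_le_factorial_inv_mul_abs_eval_nodal hu hY hsub h0 hA hcI
  have hψc : ψ.eval c ≠ 0 := eval_nodal_not_at_node (v := id)
    (fun i hi h => hcR (by rw [h]; exact hi))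
  have hω : (nodal Y id).eval c = (c - a) * (c - b) * ψ.eval c := by
    rw [nodal_eq_X_sub_C_mul_nodal_erase ha, nodal_eq_X_sub_C_mul_nodal_erase hba]
    simp [hψ, hR]
    ring
  set W := (derivative^[m] (nodal (insert t (insert c R)) id)).eval t with hW
  have hWe : W = (t - c) * (m * β') + m * ((m - 1 : ℕ) * γ') := by
    rw [hW, nodal_id_insert htR, nodal_id_insert hcR, iterate_derivative_X_sub_C_mul,
      iterate_derivative_X_sub_C_mul ψ c (m - 1)]
    simp only [eval_add, eval_mul, eval_sub, eval_X, eval_C]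
    ring
  have hsum := sum_mul_iterate_derivative_nodal_erase (insert t (insert c R)) m t
  have hcV : c ∈ insert t (insert c R) := by simp
  have hce : (insert t (insert c R)).erase c = insert t R := by
    rw [Finset.erase_insert_of_ne htc, Finset.erase_insert hcR]
  have htR' : t ∉ R := fun h => htR (Finset.mem_insert_of_mem h)
  have hcterm : (t - c) * (derivative^[m] (nodal ((insert t (insert c R)).erase c) id)).eval t =
      -((t - c) ^ 2 * α) := by
    rw [hce, nodal_id_insert htR', hq]
    linear_combination (t - c) * hcα
  have hNm : (0:ℝ) < (insert t (insert c R)).card - m := by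
    rw [hVc, sub_pos]; exact_mod_cast hmN
  have htc2 : 0 < (t - c) ^ 2 := by have := sub_ne_zero.2 htc; positivity
  have hWα : W * α ≤ 0 := by
    rcases hsign with h | h
    · have h1 := h c hcV
      rw [hcterm] at h1
      have h2 : α ≤ 0 := by
        by_contra hcon
        have := mul_pos htc2 (not_le.1 hcon)
        linarith
      have h3 : 0 ≤ W := by
        have := Finset.sum_nonneg h
        rw [hsum] at this
        exact nonneg_of_mul_nonneg_right this hNm
      exact mul_nonpos_of_nonneg_of_nonpos h3 h2
    · have h1 := h c hcV
      rw [hcterm] at h1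
      have h2 : 0 ≤ α := by
        by_contra hcon
        have := mul_neg_of_pos_of_neg htc2 (not_le.1 hcon)
        linarith
      have h3 : W ≤ 0 := by
        have := Finset.sum_nonpos h
        rw [hsum] at this
        by_contra hcon
        have := mul_pos hNm (not_le.1 hcon)
        linarith
      exact mul_nonpos_of_nonpos_of_nonneg h3 h2
  have hdecomp : (derivative^[m] (nodal Y id)).eval t = W + (c - a) * (c - b) * α := by
    rw [e0, ea, e1, hWe]
    linear_combination (t - a + c - b) * hcα
  have hadd : |W + (c - a) * (c - b) * α| = |W| + |(c - a) * (c - b) * α| := by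
    rw [abs_add_eq_add_abs_iff]
    have h1 : 0 ≤ W * ((c - a) * (c - b) * α) := by
      have := mul_nonneg_of_nonpos_of_nonpos hWα hcab.le
      linarith
    rcases lt_trichotomy W 0 with h | h | h
    · exact Or.inr ⟨h.le, nonpos_of_mul_nonneg_right h1 h⟩
    · rw [h]; rcases le_total 0 ((c - a) * (c - b) * α) with h' | h'
      · exact Or.inl ⟨le_rfl, h'⟩
      · exact Or.inr ⟨le_rfl, h'⟩
    · exact Or.inl ⟨h.le, nonneg_of_mul_nonneg_right h1 h⟩
  have hb3 : |u c / ψ.eval c * α| ≤ A / N.factorial * |(c - a) * (c - b) * α| := by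
    rw [abs_mul, abs_div, abs_mul _ α, ← mul_assoc]
    refine mul_le_mul_of_nonneg_right ?_ (abs_nonneg α)
    rw [div_le_iff₀ (abs_pos.2 hψc), mul_assoc, ← abs_mul, ← hω]
    exact hb2
  rw [hdecomp, hadd, mul_add]
  have := abs_sub_abs_le_abs_sub (iteratedDeriv m u t) (u c / ψ.eval c * α)
  linarith

section

open ComplexConjugate

theorem exists_nonneg_moments {N : ℕ} (hN : N ≠ 0) {ζ : ℕ → ℂ} {W : ℂ} (hW : ∀ k, ζ k ^ N = W)
    (ho : ∀ a ∈ Finset.range N, ∀ b ∈ Finset.range N,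
      ∑ k ∈ Finset.range N, ζ k ^ a * conj (ζ k) ^ b = if a = b then (N : ℂ) else 0) :
    ∃ ρ : ℕ → ℝ, (∀ k, 0 ≤ ρ k) ∧
      ∀ s ≤ N, ∑ k ∈ Finset.range N, (ρ k : ℂ) * ζ k ^ s = 1 + s * (W - 1) / N := by
  have hNC : (N : ℂ) ≠ 0 := by exact_mod_cast hN
  refine ⟨fun k => Complex.normSq (∑ a ∈ Finset.range N, ζ k ^ a) / N ^ 2,
    fun k => div_nonneg (Complex.normSq_nonneg _) (by positivity), ?_⟩
  have hρ : ∀ k, ((Complex.normSq (∑ a ∈ Finset.range N, ζ k ^ a) / N ^ 2 : ℝ) : ℂ) =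
      (∑ a ∈ Finset.range N, ζ k ^ a) * (∑ b ∈ Finset.range N, conj (ζ k) ^ b) / N ^ 2 := by
    intro k
    push_cast
    rw [← Complex.mul_conj, map_sum]
    simp only [map_pow]
  simp only [hρ]
  intro s
  induction s with
  | zero =>
    intro _
    have h1 : ∀ k, (∑ a ∈ Finset.range N, ζ k ^ a) * (∑ b ∈ Finset.range N, conj (ζ k) ^ b) / N ^ 2 * ζ k ^ 0 =
        (∑ a ∈ Finset.range N, ∑ b ∈ Finset.range N, ζ k ^ a * conj (ζ k) ^ b) / N ^ 2 := by
      intro k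
      rw [Finset.sum_mul_sum, pow_zero, mul_one]
    simp only [h1]
    rw [← Finset.sum_div, Finset.sum_comm]
    have h2 : ∀ a ∈ Finset.range N, ∑ k ∈ Finset.range N, ∑ b ∈ Finset.range N, ζ k ^ a * conj (ζ k) ^ b = N := by
      intro a ha
      rw [Finset.sum_comm, Finset.sum_congr rfl (ho a ha), Finset.sum_ite_eq, if_pos ha]
    rw [Finset.sum_congr rfl h2]
    simp
    field_simp
  | succ s ih =>
    intro hs
    have h1 : ∀ k, (∑ a ∈ Finset.range N, ζ k ^ a) * (∑ b ∈ Finset.range N, conj (ζ k) ^ b) / N ^ 2 *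
        ζ k ^ (s + 1) =
        (∑ a ∈ Finset.range N, ζ k ^ a) * (∑ b ∈ Finset.range N, conj (ζ k) ^ b) / N ^ 2 * ζ k ^ s +
        (∑ b ∈ Finset.range N, ζ k ^ s * conj (ζ k) ^ b) * ((W - 1) / N ^ 2) := by
      intro k
      have h2 := geom_sum_mul (ζ k) N
      rw [hW] at h2
      rw [← Finset.mul_sum, ← h2]
      ring
    simp only [h1]
    rw [Finset.sum_add_distrib, ih (by omega), ← Finset.sum_mul, Finset.sum_comm,
      Finset.sum_congr rfl (ho s (Finset.mem_range.2 (by omega))), Finset.sum_ite_eq,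
      if_pos (Finset.mem_range.2 (by omega))]
    push_cast
    field_simp
    ring

theorem sum_root_pow_mul_conj_pow {r : ℕ} (hr : r ≠ 0) (φ : ℝ) {a b : ℕ} (ha : a ∈ Finset.range (2 * r))
    (hb : b ∈ Finset.range (2 * r)) :
    ∑ k ∈ Finset.range (2 * r), Complex.exp (((φ + k * π) / r : ℝ) * Complex.I) ^ a *
      conj (Complex.exp (((φ + k * π) / r : ℝ) * Complex.I)) ^ b =
        if a = b then ((2 * r : ℕ) : ℂ) else 0 := by
  have hrC : (r : ℂ) ≠ 0 := by exact_mod_cast hr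
  have hε := Complex.isPrimitiveRoot_exp (2 * r) (by omega)
  set ε := Complex.exp (2 * π * Complex.I / ((2 * r : ℕ) : ℂ)) with hεdef
  set η := Complex.exp ((φ / r : ℝ) * Complex.I) with hη
  have hζ : ∀ k : ℕ, Complex.exp (((φ + k * π) / r : ℝ) * Complex.I) = η * ε ^ k := by
    intro k
    rw [hεdef, hη, ← Complex.exp_nat_mul, ← Complex.exp_add]
    congr 1
    push_cast
    field_simp
  have hconj : ∀ k : ℕ, conj (Complex.exp (((φ + k * π) / r : ℝ) * Complex.I)) = (η * ε ^ k)⁻¹ := by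
    intro k
    rw [← hζ, ← Complex.exp_conj, ← Complex.exp_neg]
    simp
  have hη0 : η ≠ 0 := Complex.exp_ne_zero _
  have hε0 : ε ≠ 0 := Complex.exp_ne_zero _
  have hterm : ∀ k : ℕ, Complex.exp (((φ + k * π) / r : ℝ) * Complex.I) ^ a *
      conj (Complex.exp (((φ + k * π) / r : ℝ) * Complex.I)) ^ b =
      η ^ a * (η⁻¹) ^ b * (ε ^ a * (ε⁻¹) ^ b) ^ k := by
    intro k
    rw [hconj, hζ, mul_inv, mul_pow, mul_pow, mul_pow, ← inv_pow]
    ring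
  simp only [hterm]
  rw [← Finset.mul_sum]
  split_ifs with hab
  · subst hab
    have h1 : ∀ z : ℂ, z ≠ 0 → z ^ a * z⁻¹ ^ a = 1 := by
      intro z hz; rw [← mul_pow, mul_inv_cancel₀ hz, one_pow]
    rw [h1 η hη0, h1 ε hε0]
    simp
  · have hx : ε ^ a * (ε⁻¹) ^ b ≠ 1 := by
      intro h
      apply hab
      apply hε.pow_inj (Finset.mem_range.1 ha) (Finset.mem_range.1 hb)
      rw [inv_pow] at h
      field_simp at h
      exact h
    have hxN : (ε ^ a * (ε⁻¹) ^ b) ^ (2 * r) = 1 := by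
      rw [mul_pow, ← pow_mul, ← pow_mul, mul_comm a, mul_comm b, pow_mul ε (2 * r) a,
        pow_mul ε⁻¹ (2 * r) b, inv_pow, hε.pow_eq_one]
      simp
    have h2 := geom_sum_mul (ε ^ a * (ε⁻¹) ^ b) (2 * r)
    rw [hxN, sub_self] at h2
    rw [(mul_eq_zero.1 h2).resolve_right (sub_ne_zero.2 hx), mul_zero]

theorem exists_nonneg_cos_quadrature {r : ℕ} (hr : r ≠ 0) (φ : ℝ) :
    ∃ ρ u : ℕ → ℝ, (∀ k, 0 ≤ ρ k) ∧ ∑ k ∈ Finset.range (2 * r), ρ k = 1 ∧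
      ∀ j ≤ r, ∑ k ∈ Finset.range (2 * r), ρ k * ((-1) ^ k * cos (j * u k)) =
        cos φ * cos (j * φ) + j / r * (sin φ * sin (j * φ)) := by
  have hrR : (r : ℝ) ≠ 0 := by exact_mod_cast hr
  have hrC : (r : ℂ) ≠ 0 := by exact_mod_cast hr
  obtain ⟨ρ, hρ0, hρ⟩ := exists_nonneg_moments (N := 2 * r) (by omega)
    (ζ := fun k => Complex.exp (((φ + k * π) / r : ℝ) * Complex.I))
    (W := Complex.exp ((2 * φ : ℝ) * Complex.I))
    (by
      intro k
      rw [← Complex.exp_nat_mul]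
      rw [Complex.exp_eq_exp_iff_exists_int]
      refine ⟨k, ?_⟩
      push_cast
      field_simp)
    (fun a ha b hb => sum_root_pow_mul_conj_pow hr φ ha hb)
  refine ⟨ρ, fun k => φ - (φ + k * π) / r, hρ0, ?_, ?_⟩
  · have := hρ 0 (by omega)
    simp only [pow_zero, mul_one, Nat.cast_zero, zero_mul, zero_div, add_zero] at this
    exact_mod_cast this
  · intro j hj
    have h := hρ (r - j) (by omega)
    have h2 := congrArg (fun z => (Complex.exp (((j - 1) * φ : ℝ) * Complex.I) * z).re) h
    rw [Finset.mul_sum, Complex.re_sum] at h2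
    have hl : ∀ k ∈ Finset.range (2 * r), (Complex.exp (((j - 1) * φ : ℝ) * Complex.I) *
        ((ρ k : ℂ) * Complex.exp (((φ + k * π) / r : ℝ) * Complex.I) ^ (r - j))).re =
        ρ k * ((-1) ^ k * cos (j * (φ - (φ + k * π) / r))) := by
      intro k _
      rw [← Complex.exp_nat_mul, mul_left_comm, ← Complex.exp_add, Complex.re_ofReal_mul,
        ← Real.cos_add_nat_mul_pi]
      congr 1
      have : ((j - 1) * φ : ℝ) * Complex.I +
          ((r - j : ℕ) : ℂ) * (((φ + k * π) / r : ℝ) * Complex.I) =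
          ((j * (φ - (φ + k * π) / r) + k * π : ℝ) : ℂ) * Complex.I := by
        rw [Nat.cast_sub hj]
        push_cast
        field_simp
        ring
      rw [this, Complex.exp_ofReal_mul_I_re]
    rw [Finset.sum_congr rfl hl] at h2
    rw [h2, Nat.cast_sub hj]
    have h3 : Complex.exp (((j - 1) * φ : ℝ) * Complex.I) *
        (1 + ((r : ℂ) - j) * (Complex.exp ((2 * φ : ℝ) * Complex.I) - 1) / ((2 * r : ℕ) : ℂ)) =
        (((r + j) / (2 * r) : ℝ) : ℂ) * Complex.exp (((j - 1) * φ : ℝ) * Complex.I) +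
        (((r - j) / (2 * r) : ℝ) : ℂ) * Complex.exp (((j + 1) * φ : ℝ) * Complex.I) := by
      have : Complex.exp (((j + 1) * φ : ℝ) * Complex.I) =
          Complex.exp (((j - 1) * φ : ℝ) * Complex.I) * Complex.exp ((2 * φ : ℝ) * Complex.I) := by
        rw [← Complex.exp_add]
        congr 1
        push_cast
        ring
      rw [this]
      push_cast
      field_simp
      ring
    rw [h3, Complex.add_re, Complex.re_ofReal_mul, Complex.re_ofReal_mul,
      Complex.exp_ofReal_mul_I_re, Complex.exp_ofReal_mul_I_re, sub_mul, add_mul, one_mul,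
      Real.cos_sub, Real.cos_add]
    field_simp
    ring

end

theorem sum_eval_cos_eq {r : ℕ} {φ : ℝ} {ρ u : ℕ → ℝ}
    (h : ∀ j ≤ r, ∑ k ∈ Finset.range (2 * r), ρ k * ((-1) ^ k * cos (j * u k)) =
      cos φ * cos (j * φ) + j / r * (sin φ * sin (j * φ))) :
    ∀ d ≤ r, ∀ P : ℝ[X], P.natDegree ≤ d →
      ∑ k ∈ Finset.range (2 * r), ρ k * ((-1) ^ k * P.eval (cos (u k))) =
        cos φ * P.eval (cos φ) + 1 / r * (sin φ ^ 2 * (derivative P).eval (cos φ)) := by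
  have hT : ∀ j ≤ r,
      ∑ k ∈ Finset.range (2 * r), ρ k * ((-1) ^ k * (Chebyshev.T ℝ j).eval (cos (u k))) =
        cos φ * (Chebyshev.T ℝ j).eval (cos φ) +
          1 / r * (sin φ ^ 2 * (derivative (Chebyshev.T ℝ j)).eval (cos φ)) := by
    intro j hj
    have hU := Chebyshev.U_real_cos φ (j - 1)
    rw [Chebyshev.T_derivative_eq_U]
    simp only [Chebyshev.T_real_cos, eval_mul, Int.cast_natCast, eval_natCast, h j hj]
    push_cast at hU
    rw [sub_add_cancel] at hU
    rw [← hU]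
    ring
  intro d
  induction d with
  | zero =>
    intro _ P hP
    rw [eq_C_of_natDegree_le_zero hP]
    have h0 := hT 0 (Nat.zero_le r)
    simp only [Nat.cast_zero, Chebyshev.T_zero, eval_one, derivative_one, eval_zero] at h0
    simp only [eval_C, derivative_C, eval_zero]
    simp only [← mul_assoc, ← Finset.sum_mul]
    simp only [mul_one] at h0
    rw [h0]
    ring
  | succ d ih =>
    intro hd P hP
    set c := P.coeff (d + 1) / 2 ^ d with hc
    set T := Chebyshev.T ℝ ((d + 1 : ℕ) : ℤ) with hTdef
    have hTdeg : T.natDegree = d + 1 := by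
      rw [hTdef, Chebyshev.natDegree_T]
      rfl
    have hTlead : T.coeff (d + 1) = 2 ^ d := by
      have := Chebyshev.leadingCoeff_T ℝ ((d + 1 : ℕ) : ℤ)
      rw [leadingCoeff, ← hTdef, hTdeg] at this
      exact this
    have hQ : (P - C c * T).natDegree ≤ d := by
      rw [natDegree_le_iff_coeff_eq_zero]
      intro i hi
      rw [coeff_sub, coeff_C_mul]
      rcases (show d + 1 ≤ i from hi).eq_or_lt with rfl | hi'
      · rw [hTlead, hc]
        field_simp
        ring
      · rw [coeff_eq_zero_of_natDegree_lt (by omega),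
          coeff_eq_zero_of_natDegree_lt (by omega : T.natDegree < i)]
        ring
    have h1 := ih (by omega) _ hQ
    have h2 := hT (d + 1) hd
    rw [← hTdef] at h2
    simp only [eval_sub, eval_mul, eval_C, derivative_sub, derivative_C_mul] at h1
    have h3 : ∑ k ∈ Finset.range (2 * r), ρ k * ((-1) ^ k * P.eval (cos (u k))) =
        ∑ k ∈ Finset.range (2 * r),
          ρ k * ((-1) ^ k * (P.eval (cos (u k)) - c * T.eval (cos (u k)))) +
        c * ∑ k ∈ Finset.range (2 * r), ρ k * ((-1) ^ k * T.eval (cos (u k))) := by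
      rw [Finset.mul_sum, ← Finset.sum_add_distrib]
      exact Finset.sum_congr rfl fun k _ => by ring
    rw [h3, h1, h2]
    ring

theorem abs_mul_eval_add_mul_eval_derivative_le {P : ℝ[X]} {r : ℕ} (hP : P.natDegree ≤ r) {B : ℝ}
    (hB : ∀ y ∈ Icc (-1 : ℝ) 1, |P.eval y| ≤ B) {y : ℝ} (hy : y ∈ Icc (-1 : ℝ) 1) :
    |r * y * P.eval y + (1 - y ^ 2) * (derivative P).eval y| ≤ r * B := by
  rcases eq_or_ne r 0 with rfl | hr
  · rw [eq_C_of_natDegree_le_zero hP]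
    simp
  have hr0 : (0 : ℝ) < r := by exact_mod_cast Nat.pos_of_ne_zero hr
  obtain ⟨ρ, u, hρ0, hρ1, hρ⟩ := exists_nonneg_cos_quadrature hr (arccos y)
  have h := sum_eval_cos_eq hρ r le_rfl P hP
  rw [Real.cos_arccos hy.1 hy.2, Real.sin_sq, Real.cos_arccos hy.1 hy.2] at h
  have h1 : |∑ k ∈ Finset.range (2 * r), ρ k * ((-1) ^ k * P.eval (cos (u k)))| ≤ B := by
    calc _ ≤ ∑ k ∈ Finset.range (2 * r), |ρ k * ((-1) ^ k * P.eval (cos (u k)))| :=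
          Finset.abs_sum_le_sum_abs _ _
      _ ≤ ∑ k ∈ Finset.range (2 * r), ρ k * B := by
          refine Finset.sum_le_sum fun k _ => ?_
          rw [abs_mul, abs_mul, abs_pow, abs_neg, abs_one, one_pow, one_mul,
            abs_of_nonneg (hρ0 k)]
          exact mul_le_mul_of_nonneg_left (hB _ ⟨neg_one_le_cos _, cos_le_one _⟩) (hρ0 k)
      _ = B := by rw [← Finset.sum_mul, hρ1, one_mul]
  have h2 : r * y * P.eval y + (1 - y ^ 2) * (derivative P).eval y =
      r * (y * P.eval y + 1 / r * ((1 - y ^ 2) * (derivative P).eval y)) := by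
    field_simp
  rw [h2, ← h, abs_mul, abs_of_pos hr0]
  exact mul_le_mul_of_nonneg_left h1 hr0.le

theorem abs_mul_eval_derivative_add_mul_eval_le {P : ℝ[X]} {r : ℕ} (hP : P.natDegree ≤ r) {B : ℝ}
    (hB : ∀ t ∈ Icc (0 : ℝ) 1, |P.eval t| ≤ B) {t : ℝ} (ht : t ∈ Icc (0 : ℝ) 1) :
    |2 * t * (1 - t) * (derivative P).eval t + (2 * t - 1) * (r * P.eval t)| ≤ r * B := by
  have hdeg : (P.comp (C (1 / 2) * (X + C 1))).natDegree ≤ r := by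
    refine natDegree_comp_le.trans ?_
    have : (C (1 / 2 : ℝ) * (X + C 1)).natDegree ≤ 1 := by
      compute_degree
    calc _ ≤ P.natDegree * 1 := Nat.mul_le_mul_left _ this
      _ ≤ r := by omega
  have h := abs_mul_eval_add_mul_eval_derivative_le hdeg (B := B) (y := 2 * t - 1)
    (fun y hy => by
      rw [eval_comp]
      apply hB
      simp only [eval_mul, eval_add, eval_C, eval_X]
      constructor <;> linarith [hy.1, hy.2])
    ⟨by linarith [ht.1], by linarith [ht.2]⟩
  have he : (C (1 / 2 : ℝ) * (X + C 1)).eval (2 * t - 1) = t := by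
    simp only [eval_mul, eval_add, eval_C, eval_X]
    ring
  rw [derivative_comp, eval_mul, eval_comp, eval_comp, he] at h
  simp only [derivative_C_mul, derivative_add, derivative_X, derivative_C, add_zero, mul_one,
    eval_C] at h
  convert h using 2
  ring

theorem sum_eval_iterate_derivative_nodal_erase (Y : Finset ℝ) (m : ℕ) (t : ℝ) :
    ∑ z ∈ Y, (derivative^[m] (nodal (Y.erase z) id)).eval t =
      (derivative (derivative^[m] (nodal Y id))).eval t := by
  rw [← Function.iterate_succ_apply' (f := derivative), Function.iterate_succ_apply, derivative_nodal,
    iterate_derivative_sum, eval_finsetSum]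

theorem natDegree_nodal_id (Y : Finset ℝ) : (nodal Y id).natDegree = Y.card :=
  natDegree_nodal (v := (id : ℝ → ℝ))

theorem iterate_derivative_ne_zero_of_monic {P : ℝ[X]} (hP : P.Monic) {m : ℕ}
    (hm : m ≤ P.natDegree) : derivative^[m] P ≠ 0 := by
  intro h
  have h1 := coeff_iterate_derivative (p := P) (k := m) (m := P.natDegree - m)
  rw [h, coeff_zero, Nat.sub_add_cancel hm, coeff_natDegree, hP.leadingCoeff, nsmul_eq_mul,
    mul_one] at h1
  have := Nat.pos_of_ne_zero (mt Nat.descFactorial_eq_zero_iff_lt.1 (not_lt.2 hm))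
  exact this.ne' (by exact_mod_cast h1.symm)

theorem abs_iteratedDeriv_le_of_sign {u : ℝ → ℝ} {N m : ℕ} (hmN : m < N)
    (hu : ContDiff ℝ N u) {Y : Finset ℝ} (hY : Y.card = N) {A B : ℝ} (hsub : ↑Y ⊆ Icc (0 : ℝ) 1)
    (h0 : ∀ z ∈ Y, u z = 0) (hA : ∀ x ∈ Icc (0 : ℝ) 1, |iteratedDeriv N u x| ≤ A)
    (hB : ∀ x ∈ Icc (0 : ℝ) 1, |(derivative^[m] (nodal Y id)).eval x| ≤ B)
    {t : ℝ} (ht : t ∈ Icc (0 : ℝ) 1)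
    (hs : (∀ z ∈ Y, 0 ≤ (derivative^[m] (nodal (Y.erase z) id)).eval t) ∨
      ∀ z ∈ Y, (derivative^[m] (nodal (Y.erase z) id)).eval t ≤ 0) :
    |iteratedDeriv m u t| ≤ A / N.factorial * B := by
  have hA0 : 0 ≤ A := (abs_nonneg _).trans (hA t ht)
  have hr : (0 : ℝ) < (N - m : ℕ) := by exact_mod_cast Nat.sub_pos_of_lt hmN
  have hi : interpolate Y id u = 0 := by
    rw [interpolate_apply]
    exact Finset.sum_eq_zero fun z hz => by simp [h0 z hz]
  have h1 := abs_iteratedDeriv_sub_interpolate_le hmN hu hY hsub hA ht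
  rw [hi, iterate_derivative_zero, eval_zero, sub_zero] at h1
  have hdeg : (derivative^[m] (nodal Y id)).natDegree ≤ N - m := by
    refine (natDegree_iterate_derivative _ _).trans ?_
    rw [natDegree_nodal_id, hY]
  have h2 := abs_mul_eval_derivative_add_mul_eval_le hdeg hB ht
  have hsum : ∑ z ∈ Y, (t + z - 2 * t * z) * (derivative^[m] (nodal (Y.erase z) id)).eval t =
      2 * t * (1 - t) * (derivative (derivative^[m] (nodal Y id))).eval t +
        (2 * t - 1) * ((N - m : ℕ) * (derivative^[m] (nodal Y id)).eval t) := by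
    rw [← sum_eval_iterate_derivative_nodal_erase, Nat.cast_sub hmN.le, ← hY,
      ← sum_mul_iterate_derivative_nodal_erase, Finset.mul_sum, Finset.mul_sum,
      ← Finset.sum_add_distrib]
    exact Finset.sum_congr rfl fun z _ => by ring
  have hw : ∀ z ∈ Y, |t - z| ≤ t + z - 2 * t * z := by
    intro z hz
    have hz1 := hsub hz
    rw [abs_le]
    constructor <;> nlinarith [hz1.1, hz1.2, ht.1, ht.2, mul_nonneg ht.1 (sub_nonneg.2 hz1.2),
      mul_nonneg hz1.1 (sub_nonneg.2 ht.2)]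
  have h3 : ∑ z ∈ Y, |t - z| * |(derivative^[m] (nodal (Y.erase z) id)).eval t| ≤
      (N - m : ℕ) * B := by
    refine le_trans ?_ h2
    rw [← hsum, ← sum_abs_eq_abs_sum_of_sign]
    · refine Finset.sum_le_sum fun z hz => ?_
      rw [abs_mul]
      exact mul_le_mul_of_nonneg_right ((hw z hz).trans (le_abs_self _)) (abs_nonneg _)
    · exact hs.imp
        (fun h z hz => mul_nonneg ((abs_nonneg _).trans (hw z hz)) (h z hz))
        (fun h z hz => mul_nonpos_of_nonneg_of_nonpos ((abs_nonneg _).trans (hw z hz)) (h z hz))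
  calc |iteratedDeriv m u t| ≤ _ := h1
    _ ≤ A / N.factorial / (N - m : ℕ) * ((N - m : ℕ) * B) :=
      mul_le_mul_of_nonneg_left h3 (by positivity)
    _ = A / N.factorial * B := by field_simp

theorem finite_setOf_not_abs_iteratedDeriv_le {u : ℝ → ℝ} {N m : ℕ} (hm : m ≠ 0) (hmN : m < N)
    (hu : ContDiff ℝ N u) {Y : Finset ℝ} (hY : Y.card = N) {A B : ℝ} (hsub : ↑Y ⊆ Icc (0 : ℝ) 1)
    (h0 : ∀ z ∈ Y, u z = 0) (hA : ∀ x ∈ Icc (0 : ℝ) 1, |iteratedDeriv N u x| ≤ A)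
    (hB : ∀ x ∈ Icc (0 : ℝ) 1, |(derivative^[m] (nodal Y id)).eval x| ≤ B) :
    {t ∈ Icc (0 : ℝ) 1 | ¬ |iteratedDeriv m u t| ≤ A / N.factorial * B}.Finite := by
  classical
  set E : Finset ℝ := Y ∪ Y.biUnion fun a => Y.biUnion fun b =>
    (derivative^[m - 1] (nodal ((Y.erase a).erase b) id)).roots.toFinset ∪
      Y.biUnion fun z =>
        (derivative^[m] ((X - C z) * nodal ((Y.erase a).erase b) id)).roots.toFinset with hE
  refine E.finite_toSet.subset ?_
  rintro t ⟨ht, hbad⟩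
  by_contra htE
  apply hbad
  have hA0 : 0 ≤ A := (abs_nonneg _).trans (hA t ht)
  by_cases hs : (∀ z ∈ Y, 0 ≤ (derivative^[m] (nodal (Y.erase z) id)).eval t) ∨
      ∀ z ∈ Y, (derivative^[m] (nodal (Y.erase z) id)).eval t ≤ 0
  · exact abs_iteratedDeriv_le_of_sign hmN hu hY hsub h0 hA hB ht hs
  push Not at hs
  obtain ⟨⟨a, ha, hneg⟩, b, hb, hpos⟩ := hs
  have hab : b ≠ a := by
    rintro rfl
    exact lt_asymm hneg hpos
  have hcard : ((Y.erase a).erase b).card = N - 2 := by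
    rw [Finset.card_erase_of_mem (Finset.mem_erase.2 ⟨hab, hb⟩), Finset.card_erase_of_mem ha, hY]
    omega
  have hmon : (nodal ((Y.erase a).erase b) id : ℝ[X]).Monic := nodal_monic
  rw [hE] at htE
  simp only [Finset.coe_union, Finset.coe_biUnion, Set.mem_union, Finset.mem_coe, Set.mem_iUnion,
    Multiset.mem_toFinset, not_or, not_exists] at htE
  obtain ⟨htY, htab⟩ := htE
  obtain ⟨hβ, hz⟩ := htab a ha b hb
  have h1 := abs_iteratedDeriv_le_of_sign_change hm hmN hu hY hsub h0 hA ht htY ha hb hneg hpos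
    (fun h => hβ ((mem_roots (iterate_derivative_ne_zero_of_monic hmon
      (by rw [natDegree_nodal_id, hcard]; omega))).2 h))
    (fun z hzY h => hz z hzY ((mem_roots (iterate_derivative_ne_zero_of_monic
      ((monic_X_sub_C z).mul hmon)
      (by
        rw [(monic_X_sub_C z).natDegree_mul hmon, natDegree_X_sub_C, natDegree_nodal_id, hcard]
        omega))).2 h))
  exact h1.trans (mul_le_mul_of_nonneg_left (hB t ht) (by positivity))

open MeasureTheory in
theorem abs_caputoDeriv_sub_le {α : ℝ} (hα : α < ⌈α⌉₊) {f g : ℝ → ℝ} (hf : ContDiff ℝ ⌈α⌉₊ f)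
    (hg : ContDiff ℝ ⌈α⌉₊ g) {x K : ℝ} (hx : 0 < x)
    (hK : ∀ᵐ t, t ∈ Ioc 0 x → |iteratedDeriv ⌈α⌉₊ f t - iteratedDeriv ⌈α⌉₊ g t| ≤ K) :
    |caputoDeriv α f x - caputoDeriv α g x| ≤
      K * x ^ ((⌈α⌉₊ : ℝ) - α) / Real.Gamma ((⌈α⌉₊ : ℝ) - α + 1) := by
  rw [caputoDeriv, caputoDeriv]
  set β : ℝ := (⌈α⌉₊ : ℝ) - α with hβ
  have hβ0 : 0 < β := sub_pos.2 hα
  have hrpow : IntervalIntegrable (fun τ : ℝ => (x - τ) ^ (β - 1)) volume 0 x := by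
    have h := (intervalIntegral.intervalIntegrable_rpow' (r := β - 1) (by linarith)
      (a := 0) (b := x)).comp_sub_left x
    simpa using h.symm
  have hval : ∫ τ in (0 : ℝ)..x, (x - τ) ^ (β - 1) = x ^ β / β := by
    rw [intervalIntegral.integral_comp_sub_left (fun τ => τ ^ (β - 1)) x, sub_self, sub_zero,
      integral_rpow (Or.inl (by linarith)), sub_add_cancel, Real.zero_rpow hβ0.ne', sub_zero]
  rw [← mul_sub, ← intervalIntegral.integral_sub
    (hrpow.mul_continuousOn (hf.continuous_iteratedDeriv _ le_rfl).continuousOn)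
    (hrpow.mul_continuousOn (hg.continuous_iteratedDeriv _ le_rfl).continuousOn)]
  have hbound := intervalIntegral.norm_integral_le_of_norm_le (μ := volume) hx.le
    (f := fun τ => (x - τ) ^ (β - 1) * iteratedDeriv ⌈α⌉₊ f τ -
      (x - τ) ^ (β - 1) * iteratedDeriv ⌈α⌉₊ g τ) (g := fun τ => (x - τ) ^ (β - 1) * K)
    (by
      filter_upwards [hK] with t ht htx
      have h0 : 0 ≤ (x - t) ^ (β - 1) := Real.rpow_nonneg (sub_nonneg.2 htx.2) _
      rw [← mul_sub, norm_mul, Real.norm_of_nonneg h0]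
      exact mul_le_mul_of_nonneg_left (ht htx) h0)
    (hrpow.mul_const K)
  rw [intervalIntegral.integral_mul_const, hval, Real.norm_eq_abs] at hbound
  have hΓ := Real.Gamma_pos_of_pos hβ0
  rw [abs_mul, abs_of_pos (one_div_pos.2 hΓ), Real.Gamma_add_one hβ0.ne']
  refine (mul_le_mul_of_nonneg_left hbound (one_div_pos.2 hΓ).le).trans (le_of_eq ?_)
  field_simp

theorem ae_abs_iteratedDeriv_le {u : ℝ → ℝ} {N m : ℕ} (hm : m ≠ 0) (hmN : m ≤ N)
    (hu : ContDiff ℝ N u) {Y : Finset ℝ} (hY : Y.card = N) {A B : ℝ} (hsub : ↑Y ⊆ Icc (0 : ℝ) 1)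
    (h0 : ∀ z ∈ Y, u z = 0) (hA : ∀ x ∈ Icc (0 : ℝ) 1, |iteratedDeriv N u x| ≤ A)
    (hB : ∀ x ∈ Icc (0 : ℝ) 1, |(derivative^[m] (nodal Y id)).eval x| ≤ B) :
    ∀ᵐ t : ℝ, t ∈ Icc (0 : ℝ) 1 → |iteratedDeriv m u t| ≤ A / N.factorial * B := by
  rcases hmN.eq_or_lt with rfl | hlt
  · refine Filter.Eventually.of_forall fun t ht => ?_
    have hA0 : 0 ≤ A := (abs_nonneg _).trans (hA t ht)
    have hBm : (m.factorial : ℝ) ≤ B := by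
      have h := hB t ht
      rw [← hY, iterate_derivative_nodal_card, eval_C, Nat.abs_cast, hY] at h
      exact h
    have hpos : (0 : ℝ) < m.factorial := by exact_mod_cast m.factorial_pos
    rw [div_mul_eq_mul_div, le_div_iff₀ hpos]
    exact mul_le_mul (hA t ht) hBm hpos.le hA0
  · have h := (finite_setOf_not_abs_iteratedDeriv_le hm hlt hu hY hsub h0 hA hB).measure_zero
      MeasureTheory.volume
    rw [MeasureTheory.ae_iff]
    convert h using 2
    ext t
    simp [and_assoc]

end

/-- Let `f ∈ C^{n+1}([0,1])` and let `p` be the polynomial of degree ≤ n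
interpolating `f` at distinct nodes `x_0, …, x_n ∈ [0,1]`. Let `α ∈ ℝ⁺ \ ℤ` with
`m = ⌈α⌉ ≤ n+1`. Then for each `x ∈ (0,1]`,
`|D^α f(x) - D^α p(x)| ≤ ‖f⁽ⁿ⁺¹⁾‖_∞ / ((n+1)! Γ(m-α+1)) · x^{m-α} · ‖ω⁽ᵐ⁾‖_∞`,
where `ω(t) = ∏_{k=0}^n (t - x_k)` and the sup-norms are over `[0,1]`. -/
theorem caputo_interpolation_error_bound
    (α : ℝ) (hα : 0 < α) (hαz : ∀ k : ℤ, α ≠ k)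
    (n : ℕ) (hmn : ⌈α⌉₊ ≤ n + 1)
    (f : ℝ → ℝ) (hf : ContDiff ℝ (n + 1) f)
    (nodes : Fin (n + 1) → ℝ) (hinj : Function.Injective nodes)
    (hmem : ∀ i, nodes i ∈ Set.Icc (0:ℝ) 1)
    (p : Polynomial ℝ) (hdeg : p.natDegree ≤ n)
    (hinterp : ∀ i, p.eval (nodes i) = f (nodes i))
    (A B : ℝ)
    (hA : ∀ t ∈ Set.Icc (0:ℝ) 1, |iteratedDeriv (n + 1) f t| ≤ A)
    (hB : ∀ t ∈ Set.Icc (0:ℝ) 1,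
      |iteratedDeriv ⌈α⌉₊ (fun t => ∏ k, (t - nodes k)) t| ≤ B)
    (x : ℝ) (hx : x ∈ Set.Ioc (0:ℝ) 1) :
    |caputoDeriv α f x - caputoDeriv α (fun t => p.eval t) x| ≤
      A / ((Nat.factorial (n + 1) : ℝ) * Real.Gamma ((⌈α⌉₊ : ℝ) - α + 1)) *
        x ^ ((⌈α⌉₊ : ℝ) - α) * B := by
  have hαlt : α < ⌈α⌉₊ := lt_of_le_of_ne (Nat.le_ceil α) fun h => hαz ⌈α⌉₊ (by exact_mod_cast h)
  have hm : ⌈α⌉₊ ≠ 0 := (Nat.ceil_pos.2 hα).ne'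
  have hfN : ContDiff ℝ (n + 1 : ℕ) f := by exact_mod_cast hf
  have hfm : ContDiff ℝ ⌈α⌉₊ f := hfN.of_le (by exact_mod_cast hmn)
  set Y : Finset ℝ := Finset.univ.image nodes with hYdef
  have hY : Y.card = n + 1 := by
    rw [hYdef, Finset.card_image_of_injective _ hinj, Finset.card_univ, Fintype.card_fin]
  have hnodal : (fun t : ℝ => ∏ k, (t - nodes k)) = fun t => (Lagrange.nodal Y id).eval t := by
    funext t
    rw [Lagrange.eval_nodal, hYdef, Finset.prod_image hinj.injOn]
    rfl
  simp only [hnodal, iteratedDeriv_polynomial_eval] at hB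
  have hfp : ContDiff ℝ (n + 1 : ℕ) fun t => f t - p.eval t := hfN.sub (contDiff_polynomial_eval p)
  have hae := ae_abs_iteratedDeriv_le hm hmn hfp hY
    (by
      intro z hz
      obtain ⟨i, -, rfl⟩ := Finset.mem_image.1 (Finset.mem_coe.1 hz)
      exact hmem i)
    (by
      intro z hz
      obtain ⟨i, -, rfl⟩ := Finset.mem_image.1 hz
      rw [hinterp, sub_self])
    (by
      intro t ht
      rw [iteratedDeriv_sub_polynomial hfN,
        Polynomial.iterate_derivative_eq_zero (Nat.lt_succ_of_le hdeg), Polynomial.eval_zero,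
        sub_zero]
      exact hA t ht)
    hB
  refine (abs_caputoDeriv_sub_le hαlt hfm (contDiff_polynomial_eval p) hx.1
    (K := A / (n + 1).factorial * B) ?_).trans (le_of_eq ?_)
  · filter_upwards [hae] with t ht htx
    have h := ht ⟨htx.1.le, htx.2.trans hx.2⟩
    rw [iteratedDeriv_sub_polynomial hfm] at h
    rwa [iteratedDeriv_polynomial_eval]
  · rw [div_mul_eq_div_div]
    ring
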